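/- arXiv:1007.0738 — 4 statements merged into one kernel-verified Lean document; each statement's English description precedes it below -/
import Mathlib

section
/- Let p ∈ (1,∞) and a > 0. There exists a unique function G : (0,1] → ℝ that is continuously differentiable on (0,1], satisfies G(1) = 0 and G'(y) = −F_a(y, G(y)) for all y ∈ (0,1). Moreover this G is positive on (0,1), strictly decreasing and continuous on (0,1], and infinitely differentiable on (0,1). -/
open Set Real

/-- `F_a(y,w)` from the paper (with parameter `p`). -/
noncomputable def Fa (p a y w : ℝ) : ℝ :=
  (8*p*(1/a + 2*y) + (2*p/a + 4*(3*p - 2)*y + 2*(p - 1)*y*w)*w) / (y^2 * (4 + (p - 1)*w))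

open Filter Topology
open scoped NNReal ContDiff

lemma Fa_pos {p a y w : ℝ} (hp : 1 < p) (ha : 0 < a) (hy : 0 < y) (hw : 0 ≤ w) :
    0 < Fa p a y w := by
  have h1 : 0 < p - 1 := by linarith
  have h2 : 0 < 3 * p - 2 := by linarith
  have h3 : 0 < p := by linarith
  unfold Fa
  positivity

/-- On `(0,1]` the function `F_a(y,w)` grows at most linearly in `w`. -/
lemma Fa_le {p a y w : ℝ} (hp : 1 < p) (ha : 0 < a) (hy : 0 < y) (hy1 : y ≤ 1) (hw : 0 ≤ w) :
    Fa p a y w ≤ (8 * p * (1 / a + 2) + (2 * p / a + 4 * (3 * p - 2)) + 2) / y ^ 2 * (1 + w) := by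
  have h1 : 0 < p - 1 := by linarith
  have h2 : 0 < 3 * p - 2 := by linarith
  have h3 : 0 < p := by linarith
  have hA : 8 * p * (1 / a + 2 * y) ≤ 8 * p * (1 / a + 2) := by gcongr; linarith
  have hB : 2 * p / a + 4 * (3 * p - 2) * y ≤ 2 * p / a + 4 * (3 * p - 2) := by
    nlinarith
  have hB0 : 0 ≤ 2 * p / a + 4 * (3 * p - 2) := by positivity
  have hA0 : 0 ≤ 8 * p * (1 / a + 2) := by positivity
  have hC : 2 * (p - 1) * y * w ≤ 2 * ((p - 1) * w) := by
    have : 0 ≤ (p - 1) * w := by positivity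
    nlinarith
  unfold Fa
  generalize 8 * p * (1 / a + 2 * y) = A' at *
  generalize 2 * p / a + 4 * (3 * p - 2) * y = B' at *
  generalize 8 * p * (1 / a + 2) = A at *
  generalize 2 * p / a + 4 * (3 * p - 2) = B at *
  generalize 2 * (p - 1) * y * w = C' at *
  have hq : 0 ≤ (p - 1) * w := by positivity
  generalize (p - 1) * w = q at *
  rw [div_mul_eq_mul_div, div_le_div_iff₀ (by positivity) (by positivity)]
  have key : A' + (B' + C') * w ≤ (A + B + 2) * (1 + w) * (4 + q) := by
    have e : (B' + C') * w ≤ (B + 2 * q) * w := by gcongr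
    have : 0 ≤ A * w := by positivity
    have : 0 ≤ A * q := by positivity
    have : 0 ≤ A * w * q := by positivity
    have : 0 ≤ B * w := by positivity
    have : 0 ≤ B * q := by positivity
    have : 0 ≤ B * w * q := by positivity
    nlinarith
  calc (A' + (B' + C') * w) * y ^ 2 ≤ (A + B + 2) * (1 + w) * (4 + q) * y ^ 2 := by gcongr
    _ = (A + B + 2) * (1 + w) * (y ^ 2 * (4 + q)) := by ring

lemma contDiffAt_Fa {p a y w : ℝ} (hp : 1 < p) (hy : 0 < y) (hw : 0 ≤ w) :
    ContDiffAt ℝ ∞ (Function.uncurry (Fa p a)) (y, w) := by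
  have h1 : 0 < p - 1 := by linarith
  have h2 : y ^ 2 * (4 + (p - 1) * w) ≠ 0 := by positivity
  unfold Fa Function.uncurry
  apply ContDiffAt.div
  · fun_prop
  · fun_prop
  · exact h2

lemma exists_lipschitzOnWith_Fa {p : ℝ} (a : ℝ) {l : ℝ} (M : ℝ) (hp : 1 < p) (hl : 0 < l) :
    ∃ K : ℝ≥0, ∀ y ∈ Icc l 1, LipschitzOnWith K (Fa p a y) (Icc 0 M) := by
  obtain ⟨K, hK⟩ := ContDiffOn.exists_lipschitzOnWith (n := ∞) (s := Icc l 1 ×ˢ Icc 0 M)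
    (f := Function.uncurry (Fa p a))
    (fun x hx ↦ (contDiffAt_Fa hp (hl.trans_le hx.1.1) hx.2.1).contDiffWithinAt)
    (by simp) ((convex_Icc _ _).prod (convex_Icc _ _)) (isCompact_Icc.prod isCompact_Icc)
  refine ⟨K, fun y hy ↦ LipschitzOnWith.of_dist_le_mul fun w hw z hz ↦ ?_⟩
  simpa [Prod.dist_eq] using hK.dist_le_mul (y, w) ⟨hy, hw⟩ (y, z) ⟨hy, hz⟩

/-- `G` solves `G' = -F_a(y, G)` on `(l,1)` and is continuous on `(l,1]` with `G 1 = 0`. -/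
structure IsBackwardSol (p a l : ℝ) (G : ℝ → ℝ) : Prop where
  continuousOn : ContinuousOn G (Ioc l 1)
  map_one : G 1 = 0
  hasDerivAt : ∀ y ∈ Ioo l 1, HasDerivAt G (-(Fa p a y (G y))) y

namespace IsBackwardSol

variable {p a l : ℝ} {G H : ℝ → ℝ}

lemma mono {l' : ℝ} (hG : IsBackwardSol p a l G) (h : l ≤ l') : IsBackwardSol p a l' G :=
  ⟨hG.continuousOn.mono (Ioc_subset_Ioc_left h), hG.map_one,
    fun y hy ↦ hG.hasDerivAt y ⟨h.trans_lt hy.1, hy.2⟩⟩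

lemma strictAntiOn_Icc (hG : IsBackwardSol p a l G) {z : ℝ} (hlz : l < z)
    (h : ∀ y ∈ Ioo z 1, 0 < Fa p a y (G y)) : StrictAntiOn G (Icc z 1) := by
  refine strictAntiOn_of_deriv_neg (convex_Icc z 1)
    (hG.continuousOn.mono fun y hy ↦ ⟨hlz.trans_le hy.1, hy.2⟩) fun y hy ↦ ?_
  rw [interior_Icc] at hy
  rw [(hG.hasDerivAt y ⟨hlz.trans hy.1, hy.2⟩).deriv]
  linarith [h y hy]

lemma pos (hp : 1 < p) (ha : 0 < a) (hl : 0 ≤ l) (hG : IsBackwardSol p a l G) :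
    ∀ y ∈ Ioo l 1, 0 < G y := by
  intro y hy
  have hcont : Tendsto (fun t ↦ Fa p a t (G t)) (𝓝[Ioc l 1] 1) (𝓝 (Fa p a 1 0)) := by
    have hG1 : Tendsto G (𝓝[Ioc l 1] 1) (𝓝 0) := by
      simpa [ContinuousWithinAt, hG.map_one] using hG.continuousOn 1 ⟨hy.1.trans hy.2, le_rfl⟩
    have h1 := (contDiffAt_Fa (a := a) hp one_pos le_rfl).continuousAt.tendsto
    exact h1.comp ((tendsto_id.mono_left nhdsWithin_le_nhds).prodMk_nhds hG1)
  have hev : ∀ᶠ t in 𝓝[Ioc l 1] 1, 0 < Fa p a t (G t) :=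
    hcont.eventually_const_lt (Fa_pos hp ha one_pos le_rfl)
  rw [nhdsWithin_Ioc_eq_nhdsLE (hy.1.trans hy.2)] at hev
  obtain ⟨d, hd, hdF⟩ := mem_nhdsLE_iff_exists_Icc_subset.1 hev
  by_contra! hneg
  have hm : y ≤ max d y := le_max_right _ _
  have hm1 : max d y < 1 := max_lt hd hy.2
  have hanti : StrictAntiOn G (Icc (max d y) 1) :=
    hG.strictAntiOn_Icc (hy.1.trans_le hm) fun t ht ↦
      hdF ⟨(le_max_left d y).trans ht.1.le, ht.2.le⟩
  have hcomp : IsCompact (Icc y (max d y) ∩ G ⁻¹' Iic 0) := by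
    refine isCompact_Icc.of_isClosed_subset ?_ inter_subset_left
    exact (hG.continuousOn.mono fun t ht ↦ ⟨hy.1.trans_le ht.1, ht.2.trans hm1.le⟩)
      |>.preimage_isClosed_of_isClosed isClosed_Icc isClosed_Iic
  obtain ⟨z, hz, hzmax⟩ := hcomp.exists_isGreatest ⟨y, ⟨le_rfl, hm⟩, hneg⟩
  have hz1 : z < 1 := hz.1.2.trans_lt hm1
  have hlz : l < z := hy.1.trans_le hz.1.1
  have hpos : ∀ t ∈ Ioo z 1, 0 < G t := by
    intro t ht
    rcases le_or_gt t (max d y) with htm | htm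
    · by_contra! hGt
      exact absurd (hzmax ⟨⟨hz.1.1.trans ht.1.le, htm⟩, hGt⟩) (not_le.2 ht.1)
    · have := hanti ⟨htm.le, ht.2.le⟩ ⟨hm1.le, le_rfl⟩ ht.2
      rwa [hG.map_one] at this
  have := hG.strictAntiOn_Icc hlz
    (fun t ht ↦ Fa_pos hp ha ((hl.trans_lt hlz).trans ht.1) (hpos t ht).le)
    ⟨le_rfl, hz1.le⟩ ⟨hz1.le, le_rfl⟩ hz1
  rw [hG.map_one] at this
  exact absurd hz.2 (not_le.2 this)

lemma nonneg (hp : 1 < p) (ha : 0 < a) (hl : 0 ≤ l) (hG : IsBackwardSol p a l G) :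
    ∀ y ∈ Ioc l 1, 0 ≤ G y := by
  intro y hy
  rcases hy.2.lt_or_eq with h | rfl
  · exact (hG.pos hp ha hl y ⟨hy.1, h⟩).le
  · exact hG.map_one.ge

lemma strictAntiOn (hp : 1 < p) (ha : 0 < a) (hl : 0 ≤ l) (hG : IsBackwardSol p a l G) :
    StrictAntiOn G (Ioc l 1) := by
  refine strictAntiOn_of_deriv_neg (convex_Ioc l 1) hG.continuousOn fun y hy ↦ ?_
  rw [interior_Ioc] at hy
  rw [(hG.hasDerivAt y hy).deriv]
  linarith [Fa_pos hp ha (hl.trans_lt hy.1) (hG.pos hp ha hl y hy).le]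

lemma eqOn (hp : 1 < p) (ha : 0 < a) (hl : 0 ≤ l) (hG : IsBackwardSol p a l G)
    (hH : IsBackwardSol p a l H) : EqOn G H (Ioc l 1) := by
  intro y hy
  have hsub : Icc y 1 ⊆ Ioc l 1 := fun t ht ↦ ⟨hy.1.trans_le ht.1, ht.2⟩
  obtain ⟨K, hK⟩ := exists_lipschitzOnWith_Fa a (max (G y) (H y)) hp (hl.trans_lt hy.1)
  have hGm : ∀ t ∈ Icc y 1, G t ∈ Icc 0 (max (G y) (H y)) := fun t ht ↦
    ⟨hG.nonneg hp ha hl t (hsub ht), le_max_of_le_left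
      ((hG.strictAntiOn hp ha hl).antitoneOn hy (hsub ht) ht.1)⟩
  have hHm : ∀ t ∈ Icc y 1, H t ∈ Icc 0 (max (G y) (H y)) := fun t ht ↦
    ⟨hH.nonneg hp ha hl t (hsub ht), le_max_of_le_right
      ((hH.strictAntiOn hp ha hl).antitoneOn hy (hsub ht) ht.1)⟩
  have hmono : MonotoneOn (fun t ↦ (G t - H t) ^ 2 * exp (2 * K * t)) (Icc y 1) := by
    refine monotoneOn_of_hasDerivWithinAt_nonneg (convex_Icc y 1)
      (f' := fun t ↦ (2 * (G t - H t) * (-(Fa p a t (G t)) - -(Fa p a t (H t)))) *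
        exp (2 * K * t) + (G t - H t) ^ 2 * (exp (2 * K * t) * (2 * K))) ?_ ?_ ?_
    · have h1 := hG.continuousOn.mono hsub
      have h2 := hH.continuousOn.mono hsub
      fun_prop
    · intro t ht
      rw [interior_Icc] at ht
      have ht' : t ∈ Ioo l 1 := ⟨hy.1.trans ht.1, ht.2⟩
      have h1 := ((hG.hasDerivAt t ht').fun_sub (hH.hasDerivAt t ht')).fun_pow 2
      have h2 := ((hasDerivAt_id t).const_mul (2 * (K : ℝ))).exp
      simpa using! (h1.mul h2).hasDerivWithinAt
    · intro t ht
      have ht := interior_subset ht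
      have h1 := (hK t ht).dist_le_mul _ (hGm t ht) _ (hHm t ht)
      rw [Real.dist_eq, Real.dist_eq] at h1
      have h2 : (G t - H t) * (Fa p a t (G t) - Fa p a t (H t)) ≤ K * (G t - H t) ^ 2 := by
        calc _ ≤ |G t - H t| * |Fa p a t (G t) - Fa p a t (H t)| := by
              rw [← abs_mul]; exact le_abs_self _
          _ ≤ |G t - H t| * (K * |G t - H t|) := by gcongr
          _ = K * (G t - H t) ^ 2 := by rw [← sq_abs]; ring
      nlinarith [exp_pos (2 * K * t)]
  have h := hmono ⟨le_rfl, hy.2⟩ ⟨hy.2, le_rfl⟩ hy.2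
  simp only [hG.map_one, hH.map_one, sub_self, ne_eq, OfNat.ofNat_ne_zero, not_false_eq_true,
    zero_pow, zero_mul] at h
  have h0 : (G y - H y) ^ 2 ≤ 0 := by
    by_contra! hc
    exact absurd h (not_le.2 (mul_pos hc (exp_pos _)))
  exact sub_eq_zero.1 (pow_eq_zero_iff two_ne_zero |>.1 (le_antisymm h0 (sq_nonneg _)))

end IsBackwardSol

/-- The vector field truncated to `0 ≤ w ≤ M` has a solution down to any `l > 0`. -/
lemma exists_truncated_sol {p l M : ℝ} (a : ℝ) (hp : 1 < p) (hl : 0 < l) (hl1 : l < 1)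
    (hM : 0 ≤ M) : ∃ g : ℝ → ℝ, g 1 = 0 ∧ ∀ t ∈ Icc l 1,
      HasDerivWithinAt g (-(Fa p a t (max 0 (min (g t) M)))) (Icc l 1) t := by
  obtain ⟨K, hK⟩ := exists_lipschitzOnWith_Fa a M hp hl
  have hmem : ∀ w, max 0 (min w M) ∈ Icc 0 M := fun w ↦
    ⟨le_max_left _ _, max_le hM (min_le_right _ _)⟩
  have hcont : ContinuousOn (Function.uncurry (Fa p a)) (Icc l 1 ×ˢ Icc 0 M) := fun x hx ↦
    (contDiffAt_Fa hp (hl.trans_le hx.1.1) hx.2.1).continuousAt.continuousWithinAt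
  obtain ⟨L, hL⟩ := (isCompact_Icc.prod isCompact_Icc).exists_bound_of_continuousOn hcont
  have hPL : IsPicardLindelof (fun t w ↦ -(Fa p a t (max 0 (min w M))))
      (⟨1, hl1.le, le_rfl⟩ : Icc l 1) 0 L.toNNReal 0 L.toNNReal K := by
    refine ⟨fun t ht ↦ ?_, fun w _ ↦ ?_, fun t ht w _ ↦ ?_, ?_⟩
    · have h1 : LipschitzWith 1 fun w : ℝ ↦ max 0 (min w M) :=
        (LipschitzWith.id.min_const M).const_max 0
      have h2 := (hK t ht).comp (h1.lipschitzOnWith (s := Metric.closedBall 0 L.toNNReal))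
        fun w _ ↦ hmem w
      rw [mul_one] at h2
      exact h2.neg
    · exact (hcont.comp (f := fun t ↦ (t, max 0 (min w M))) (by fun_prop)
        fun t ht ↦ ⟨ht, hmem w⟩).neg
    · rw [norm_neg]
      exact (hL (t, _) ⟨ht, hmem w⟩).trans (le_coe_toNNReal L)
    · simp only [sub_self, NNReal.coe_zero, sub_zero]
      exact mul_le_of_le_one_right L.toNNReal.2 (max_le zero_le_one (by linarith))
  exact hPL.exists_eq_forall_mem_Icc_hasDerivWithinAt₀

lemma exists_isBackwardSol {p a l : ℝ} (hp : 1 < p) (ha : 0 < a) (hl : 0 < l) (hl1 : l < 1) :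
    ∃ g : ℝ → ℝ, IsBackwardSol p a l g ∧ ContDiffOn ℝ ∞ g (Icc l 1) := by
  set C := (8 * p * (1 / a + 2) + (2 * p / a + 4 * (3 * p - 2)) + 2) / l ^ 2 with hC
  have hc : 0 < 8 * p * (1 / a + 2) + (2 * p / a + 4 * (3 * p - 2)) + 2 := by
    have : 0 < 3 * p - 2 := by linarith
    have : 0 < p := by linarith
    positivity
  have hC0 : 0 < C := by positivity
  obtain ⟨g, hg1, hg⟩ := exists_truncated_sol (M := exp C) a hp hl hl1 (exp_pos C).le
  have hgc : ContinuousOn g (Icc l 1) := HasDerivWithinAt.continuousOn hg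
  have hd : ∀ t ∈ interior (Icc l 1),
      HasDerivAt g (-(Fa p a t (max 0 (min (g t) (exp C))))) t := by
    intro t ht
    rw [interior_Icc] at ht
    exact (hg t (Ioo_subset_Icc_self ht)).hasDerivAt (Icc_mem_nhds ht.1 ht.2)
  have hanti : AntitoneOn g (Icc l 1) := by
    refine (strictAntiOn_of_deriv_neg (convex_Icc l 1) hgc fun t ht ↦ ?_).antitoneOn
    rw [(hd t ht).deriv]
    linarith [Fa_pos hp ha (hl.trans_le (interior_subset ht).1)
      (le_max_left 0 (min (g t) (exp C)))]
  have hg0 : ∀ t ∈ Icc l 1, 0 ≤ g t := fun t ht ↦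
    hg1 ▸ hanti ht ⟨hl1.le, le_rfl⟩ ht.2
  have hmono : MonotoneOn (fun t ↦ (1 + g t) * exp (C * t)) (Icc l 1) := by
    refine monotoneOn_of_hasDerivWithinAt_nonneg (convex_Icc l 1)
      (f' := fun t ↦ -(Fa p a t (max 0 (min (g t) (exp C)))) * exp (C * t) +
        (1 + g t) * (exp (C * t) * C)) (by fun_prop) ?_ ?_
    · intro t ht
      have h2 := ((hasDerivAt_id t).const_mul C).exp
      simpa using! (((hd t ht).const_add 1).mul h2).hasDerivWithinAt
    · intro t ht
      have ht := interior_subset ht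
      have htp := hl.trans_le ht.1
      have h1 := Fa_le hp ha htp ht.2 (le_max_left 0 (min (g t) (exp C)))
      have h2 : max 0 (min (g t) (exp C)) ≤ g t := max_le (hg0 t ht) (min_le_left _ _)
      have h3 : Fa p a t (max 0 (min (g t) (exp C))) ≤ C * (1 + g t) := by
        refine h1.trans ?_
        rw [hC]
        gcongr
        exact ht.1
      nlinarith [exp_pos (C * t)]
  have hgM : ∀ t ∈ Icc l 1, g t ≤ exp C := by
    intro t ht
    have h1 := hmono ht ⟨hl1.le, le_rfl⟩ ht.2
    simp only [hg1, add_zero, one_mul, mul_one] at h1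
    have h2 : 1 ≤ exp (C * t) := one_le_exp (mul_nonneg hC0.le (hl.le.trans ht.1))
    nlinarith [hg0 t ht]
  have hg' : ∀ t ∈ Icc l 1, HasDerivWithinAt g (-(Fa p a t (g t))) (Icc l 1) t := by
    intro t ht
    have := hg t ht
    rwa [min_eq_left (hgM t ht), max_eq_right (hg0 t ht)] at this
  refine ⟨g, ⟨hgc.mono Ioc_subset_Icc_self, hg1, fun y hy ↦
    (hg' y (Ioo_subset_Icc_self hy)).hasDerivAt (Icc_mem_nhds hy.1 hy.2)⟩, ?_⟩
  exact ODE.contDiffOn_enat_Icc_of_hasDerivWithinAt (n := ⊤) (f := fun t w ↦ -(Fa p a t w))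
    (u := Ici 0)
    (fun x hx ↦ (contDiffAt_Fa hp (hl.trans_le hx.1.1) hx.2).neg.contDiffWithinAt) hg' hg0

lemma exists_isBackwardSol_zero {p a : ℝ} (hp : 1 < p) (ha : 0 < a) :
    ∃ G : ℝ → ℝ, IsBackwardSol p a 0 G ∧ ContDiffOn ℝ ∞ G (Ioc 0 1) := by
  choose! g hg hgs using fun l (h : l ∈ Ioo (0 : ℝ) 1) ↦ exists_isBackwardSol hp ha h.1 h.2
  have half : ∀ y ∈ Ioc (0 : ℝ) 1, y / 2 ∈ Ioo (0 : ℝ) 1 := fun y hy ↦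
    ⟨by linarith [hy.1], by linarith [hy.2]⟩
  have key : ∀ l ∈ Ioo (0 : ℝ) 1, EqOn (fun y ↦ g (y / 2) y) (g l) (Ioc l 1) := by
    intro l hl y hy
    have hy2 := half y ⟨hl.1.trans hy.1, hy.2⟩
    exact ((hg _ hy2).mono (le_max_left (y / 2) l)).eqOn hp ha (hy2.1.le.trans (le_max_left _ _))
      ((hg l hl).mono (le_max_right _ _)) ⟨max_lt (by linarith [hl.1, hy.1]) hy.1, hy.2⟩
  have hsm : ContDiffOn ℝ ∞ (fun y ↦ g (y / 2) y) (Ioc 0 1) := by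
    intro y hy
    have hy2 := half y hy
    have hmem : y ∈ Ioc (y / 2) 1 := ⟨by linarith [hy.1], hy.2⟩
    have h1 : ContDiffWithinAt ℝ ∞ (fun y ↦ g (y / 2) y) (Ioc (y / 2) 1) y :=
      (((hgs _ hy2).mono Ioc_subset_Icc_self) y hmem).congr (key _ hy2) (key _ hy2 hmem)
    refine h1.mono_of_mem_nhdsWithin ?_
    filter_upwards [self_mem_nhdsWithin, mem_nhdsWithin_of_mem_nhds (Ioi_mem_nhds hmem.1)]
      with t ht ht' using ⟨ht', ht.2⟩
  refine ⟨fun y ↦ g (y / 2) y, ⟨hsm.continuousOn, (hg _ (half 1 (by simp))).map_one, ?_⟩, hsm⟩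
  intro y hy
  have hy2 := half y (Ioo_subset_Ioc_self hy)
  have hmem : y ∈ Ioo (y / 2) 1 := ⟨by linarith [hy.1], hy.2⟩
  refine ((hg _ hy2).hasDerivAt y hmem).congr_of_eventuallyEq ?_
  filter_upwards [Ioo_mem_nhds hmem.1 hmem.2] with t ht
    using key _ hy2 (Ioo_subset_Ioc_self ht)

theorem existence_uniqueness_G (p a : ℝ) (hp : 1 < p) (ha : 0 < a) :
    ∃ G : ℝ → ℝ,
      (ContDiffOn ℝ 1 G (Set.Ioc 0 1) ∧ G 1 = 0 ∧
        ∀ y ∈ Set.Ioo (0:ℝ) 1, HasDerivAt G (-(Fa p a y (G y))) y) ∧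
      (∀ G' : ℝ → ℝ,
        (ContDiffOn ℝ 1 G' (Set.Ioc 0 1) ∧ G' 1 = 0 ∧
          ∀ y ∈ Set.Ioo (0:ℝ) 1, HasDerivAt G' (-(Fa p a y (G' y))) y) →
        Set.EqOn G G' (Set.Ioc 0 1)) ∧
      (∀ y ∈ Set.Ioo (0:ℝ) 1, 0 < G y) ∧
      StrictAntiOn G (Set.Ioc 0 1) ∧
      ContinuousOn G (Set.Ioc 0 1) ∧
      ContDiffOn ℝ (⊤ : ℕ∞) G (Set.Ioo 0 1) := by
  obtain ⟨G, hG, hsm⟩ := exists_isBackwardSol_zero hp ha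
  refine ⟨G, ⟨hsm.of_le (by exact_mod_cast le_top), hG.map_one, hG.hasDerivAt⟩, ?_,
    hG.pos hp ha le_rfl, hG.strictAntiOn hp ha le_rfl, hG.continuousOn,
    hsm.mono Ioo_subset_Ioc_self⟩
  rintro H ⟨hH, hH1, hHd⟩
  exact hG.eqOn hp ha le_rfl ⟨hH.continuousOn, hH1, hHd⟩
end

section
/- Let p ∈ (1,∞). Then lim_{y→0⁺} (log K(y)) / (−log y) = 2. -/
open Set Real Filter MeasureTheory

/-- `G` is the family `a ↦ G_a` of solutions of `G_a' = -F_a(y, G_a)` on `(0,1)`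
with `G_a(1) = 0`: each `G_a` is continuous on `(0,1]`, positive on `(0,1)` and
strictly decreasing on `(0,1]`. -/
def IsGFamily (p : ℝ) (G : ℝ → ℝ → ℝ) : Prop :=
  ∀ a : ℝ, 0 < a →
    ContinuousOn (G a) (Set.Ioc 0 1) ∧
    G a 1 = 0 ∧
    (∀ y ∈ Set.Ioo (0:ℝ) 1, HasDerivAt (G a) (-(Fa p a y (G a y))) y) ∧
    (∀ y ∈ Set.Ioo (0:ℝ) 1, 0 < G a y) ∧
    StrictAntiOn (G a) (Set.Ioc 0 1)

lemma sq_mul_Fa {p a y w : ℝ} (hp : 1 < p) (hy : 0 < y) (hw : 0 ≤ w) :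
    y ^ 2 * Fa p a y w = (8 * p * (a⁻¹ + 2 * y) +
      (2 * p * a⁻¹ + 4 * (3 * p - 2) * y + 2 * (p - 1) * y * w) * w) / (4 + (p - 1) * w) := by
  have hD : 0 < 4 + (p - 1) * w := by nlinarith
  unfold Fa
  field_simp

lemma four_mul_le_sq_mul_Fa {p a y w : ℝ} (hp : 1 < p) (ha : 0 < a) (hy : 0 < y) (hw : 0 ≤ w) :
    4 * y ≤ y ^ 2 * Fa p a y w := by
  have hq : 0 < p - 1 := by linarith
  rw [sq_mul_Fa hp hy hw, le_div_iff₀ (by positivity)]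
  have h₁ : 0 ≤ (p - 1) * y := by positivity
  have h₂ : 0 ≤ p * y * w := by positivity
  have h₃ : 0 ≤ (p - 1) * y * w := by positivity
  have h₄ : 0 ≤ (p - 1) * y * w ^ 2 := by positivity
  have h₅ : 0 ≤ p * a⁻¹ := by positivity
  have h₆ : 0 ≤ p * a⁻¹ * w := by positivity
  have h₇ : 0 ≤ y * w := by positivity
  nlinarith

lemma le_sq_mul_Fa {p a y w : ℝ} (hp : 1 < p) (ha : 0 < a) (hy : 0 < y) (hw : 0 ≤ w) :
    y * (2 * w - (4 * p + 16 * p / (p - 1))) ≤ y ^ 2 * Fa p a y w := by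
  have hq : 0 < p - 1 := by linarith
  rw [sq_mul_Fa hp hy hw, le_div_iff₀ (by positivity)]
  have h : 16 * p / (p - 1) * (p - 1) = 16 * p := div_mul_cancel₀ _ hq.ne'
  have h₀ : 0 ≤ 16 * p / (p - 1) := by positivity
  generalize 16 * p / (p - 1) = c at h h₀ ⊢
  have e : y * (2 * w - (4 * p + c)) * (4 + (p - 1) * w) =
      y * (2 * w - 4 * p) * (4 + (p - 1) * w) - 4 * y * c - y * w * (c * (p - 1)) := by ring
  rw [e, h]
  have h₁ : 0 ≤ y * c := by positivity
  have h₂ : 0 ≤ p * y * w := by positivity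
  have h₃ : 0 ≤ p * ((p - 1) * y * w) := by positivity
  have h₅ : 0 ≤ p * a⁻¹ := by positivity
  have h₆ : 0 ≤ p * a⁻¹ * w := by positivity
  have h₇ : 0 ≤ (p - 1) * (y * w) := by positivity
  have h₈ : 0 ≤ p * y := by positivity
  nlinarith

lemma sq_mul_Fa_le {p a y w : ℝ} (hp : 1 < p) (ha : 0 < a) (hy : 0 < y) (hw : 0 ≤ w) :
    y ^ 2 * Fa p a y w ≤
      y * (2 * w + (4 * p + 16 * p / (p - 1))) + (4 * p + 16 * p / (p - 1)) * a⁻¹ := by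
  have hq : 0 < p - 1 := by linarith
  rw [sq_mul_Fa hp hy hw, div_le_iff₀ (by positivity)]
  have h : 16 * p / (p - 1) * (p - 1) = 16 * p := div_mul_cancel₀ _ hq.ne'
  have h₀ : 0 ≤ 16 * p / (p - 1) := by positivity
  generalize 16 * p / (p - 1) = c at h h₀ ⊢
  have e : (y * (2 * w + (4 * p + c)) + (4 * p + c) * a⁻¹) * (4 + (p - 1) * w) =
      (y * (2 * w + 4 * p) + 4 * p * a⁻¹) * (4 + (p - 1) * w) + 4 * y * c + 4 * c * a⁻¹
        + (y * w + a⁻¹ * w) * (c * (p - 1)) := by ring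
  rw [e, h]
  have h₁ : 0 ≤ y * c := by positivity
  have h₂ : 0 ≤ p * y * w := by positivity
  have h₃ : 0 ≤ p * ((p - 1) * y * w) := by positivity
  have h₄ : 0 ≤ c * a⁻¹ := by positivity
  have h₅ : 0 ≤ p * a⁻¹ := by positivity
  have h₆ : 0 ≤ p * a⁻¹ * w := by positivity
  have h₇ : 0 ≤ y * w := by positivity
  have h₈ : 0 ≤ p * a⁻¹ * ((p - 1) * w) := by positivity
  nlinarith

lemma antitoneOn_Ioc_of_hasDerivAt_nonpos {f f' : ℝ → ℝ} (hc : ContinuousOn f (Ioc 0 1))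
    (hd : ∀ y ∈ Ioo (0 : ℝ) 1, HasDerivAt f (f' y) y) (hf : ∀ y ∈ Ioo (0 : ℝ) 1, f' y ≤ 0) :
    AntitoneOn f (Ioc 0 1) := by
  apply antitoneOn_of_deriv_nonpos (convex_Ioc 0 1) hc
  · rw [interior_Ioc]
    exact fun y hy => (hd y hy).differentiableAt.differentiableWithinAt
  · rw [interior_Ioc]
    exact fun y hy => (hd y hy).deriv ▸ hf y hy

section

variable {p a : ℝ} {G : ℝ → ℝ → ℝ}

lemma IsGFamily.neg_four_mul_log_le (hG : IsGFamily p G) (hp : 1 < p) (ha : 0 < a) {y : ℝ}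
    (hy : y ∈ Ioc (0 : ℝ) 1) : -4 * Real.log y ≤ G a y := by
  obtain ⟨hc, h1, hd, hpos, -⟩ := hG a ha
  have h : AntitoneOn (fun y => G a y + 4 * Real.log y) (Ioc 0 1) := by
    refine antitoneOn_Ioc_of_hasDerivAt_nonpos
      (hc.add (continuousOn_const.mul (continuousOn_log.mono fun x hx => hx.1.ne')))
      (fun x hx => (hd x hx).add ((hasDerivAt_log hx.1.ne').const_mul 4)) fun x hx => ?_
    have hx0 := hx.1
    have := four_mul_le_sq_mul_Fa hp ha hx0 (hpos x hx).le
    have : 4 * x⁻¹ ≤ Fa p a x (G a x) := by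
      rw [← div_eq_mul_inv, div_le_iff₀ hx0]
      nlinarith
    linarith
  have := h hy ⟨one_pos, le_rfl⟩ hy.2
  simp only [h1, Real.log_one] at this
  linarith

lemma IsGFamily.antitoneOn_sq_mul_sub (hG : IsGFamily p G) (hp : 1 < p) (ha : 0 < a) :
    AntitoneOn (fun y => y ^ 2 * (G a y - (2 * p + 8 * p / (p - 1)))) (Ioc 0 1) := by
  obtain ⟨hc, -, hd, hpos, -⟩ := hG a ha
  refine antitoneOn_Ioc_of_hasDerivAt_nonpos
    ((continuousOn_id.pow 2).mul (hc.sub continuousOn_const))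
    (fun x hx => (hasDerivAt_pow 2 x).mul ((hd x hx).sub_const _)) fun x hx => ?_
  have := le_sq_mul_Fa hp ha hx.1 (hpos x hx).le
  have e : 16 * p / (p - 1) = 2 * (8 * p / (p - 1)) := by ring
  rw [e] at this
  norm_num
  linarith

lemma IsGFamily.sq_mul_add_le (hG : IsGFamily p G) (hp : 1 < p) (ha : 0 < a) {y : ℝ}
    (hy : y ∈ Ioc (0 : ℝ) 1) :
    y ^ 2 * (G a y + (2 * p + 8 * p / (p - 1))) + (4 * p + 16 * p / (p - 1)) * a⁻¹ * y ≤
      2 * p + 8 * p / (p - 1) + (4 * p + 16 * p / (p - 1)) * a⁻¹ := by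
  obtain ⟨hc, h1, hd, hpos, -⟩ := hG a ha
  have h : AntitoneOn (fun y => -(y ^ 2 * (G a y + (2 * p + 8 * p / (p - 1))) +
      (4 * p + 16 * p / (p - 1)) * a⁻¹ * y)) (Ioc 0 1) := by
    refine antitoneOn_Ioc_of_hasDerivAt_nonpos
      (((continuousOn_id.pow 2).mul (hc.add continuousOn_const)).add
        (continuousOn_const.mul continuousOn_id)).neg
      (fun x hx => (((hasDerivAt_pow 2 x).mul ((hd x hx).add_const _)).add
        ((hasDerivAt_id x).const_mul _)).neg) fun x hx => ?_
    have := sq_mul_Fa_le hp ha hx.1 (hpos x hx).le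
    have e : 16 * p / (p - 1) = 2 * (8 * p / (p - 1)) := by ring
    rw [e] at this ⊢
    norm_num
    linarith
  have := h hy ⟨one_pos, le_rfl⟩ hy.2
  simp only [h1] at this
  linarith

end

lemma tendsto_log_div_neg_log {K : ℝ → ℝ} {c C y₀ : ℝ} (hc : 0 < c) (hy₀ : 0 < y₀)
    (hl : ∀ y, 0 < y → y ≤ y₀ → c ≤ y ^ 2 * K y) (hu : ∀ y, 0 < y → y ≤ y₀ → y ^ 2 * K y ≤ C) :
    Tendsto (fun y => Real.log (K y) / (-Real.log y)) (nhdsWithin 0 (Ioi 0)) (nhds 2) := by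
  have hlog : Tendsto (fun y => -Real.log y) (nhdsWithin 0 (Ioi 0)) atTop :=
    tendsto_neg_atBot_atTop.comp tendsto_log_nhdsGT_zero
  have key (d : ℝ) : Tendsto (fun y => 2 + d / (-Real.log y)) (nhdsWithin 0 (Ioi 0)) (nhds 2) := by
    simpa using (hlog.const_div_atTop d).const_add 2
  have hev : ∀ᶠ y in nhdsWithin (0 : ℝ) (Ioi 0), 0 < y ∧ y ≤ y₀ ∧ 0 < -Real.log y := by
    filter_upwards [Ioc_mem_nhdsGT hy₀, hlog.eventually_gt_atTop 0] with y hy h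
    exact ⟨hy.1, hy.2, h⟩
  have hK {y : ℝ} (hy : 0 < y) (h : y ≤ y₀) (hL : 0 < -Real.log y) :
      Real.log (K y) / (-Real.log y) = 2 + Real.log (y ^ 2 * K y) / (-Real.log y) := by
    have : 0 < K y := pos_of_mul_pos_right (hc.trans_le (hl y hy h)) (by positivity)
    rw [Real.log_mul (by positivity) this.ne', Real.log_pow]
    have : Real.log y ≠ 0 := neg_ne_zero.1 hL.ne'
    push_cast
    field_simp
    ring
  refine tendsto_of_tendsto_of_tendsto_of_le_of_le' (key (Real.log c)) (key (Real.log C)) ?_ ?_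
  · filter_upwards [hev] with y ⟨hy, h, hL⟩
    rw [hK hy h hL]
    gcongr
    exact hl y hy h
  · filter_upwards [hev] with y ⟨hy, h, hL⟩
    rw [hK hy h hL]
    gcongr
    · exact hc.trans_le (hl y hy h)
    · exact hu y hy h

theorem K_log_asymptotics_at_zero (p : ℝ) (hp : 1 < p) (G : ℝ → ℝ → ℝ) (K : ℝ → ℝ)
    (hG : IsGFamily p G)
    (hK : ∀ y ∈ Set.Ioc (0:ℝ) 1,
      Filter.Tendsto (fun a => G a y) Filter.atTop (nhds (K y))) :
    Filter.Tendsto (fun y => Real.log (K y) / (-Real.log y))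
      (nhdsWithin 0 (Set.Ioi 0)) (nhds 2) := by
  have hq : 0 < p - 1 := by linarith
  set B := 2 * p + 8 * p / (p - 1) with hB
  have hB0 : 0 < B := by positivity
  set y₀ := Real.exp (-(B + 1) / 4) with hy₀
  have hy₀0 : 0 < y₀ := Real.exp_pos _
  have hy₀1 : y₀ ≤ 1 := Real.exp_le_one_iff.2 (by linarith)
  refine tendsto_log_div_neg_log (c := y₀ ^ 2) (C := B) (by positivity) hy₀0 ?_ ?_
  · intro y hy h
    refine ge_of_tendsto ((hK y ⟨hy, h.trans hy₀1⟩).const_mul _) ?_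
    filter_upwards [eventually_gt_atTop 0] with a ha
    have h₁ := hG.antitoneOn_sq_mul_sub hp ha ⟨hy, h.trans hy₀1⟩ ⟨hy₀0, hy₀1⟩ h
    have h₂ := hG.neg_four_mul_log_le hp ha ⟨hy₀0, hy₀1⟩
    rw [hy₀, Real.log_exp, ← hy₀] at h₂
    simp only [← hB] at h₁
    have h₃ : y₀ ^ 2 * 1 ≤ y₀ ^ 2 * (G a y₀ - B) := by
      gcongr
      linarith
    have h₄ : 0 ≤ y ^ 2 * B := by positivity
    linarith
  · intro y hy h
    have hyI : y ∈ Ioc (0 : ℝ) 1 := ⟨hy, h.trans hy₀1⟩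
    have hlim : Tendsto (fun a : ℝ => B + (4 * p + 16 * p / (p - 1)) * a⁻¹) atTop (nhds B) := by
      simpa using (tendsto_inv_atTop_zero.const_mul (4 * p + 16 * p / (p - 1))).const_add B
    refine le_of_tendsto_of_tendsto ((hK y hyI).const_mul _) hlim ?_
    filter_upwards [eventually_gt_atTop 0] with a ha
    have h₁ := hG.sq_mul_add_le hp ha hyI
    rw [← hB] at h₁
    have h₂ : 0 ≤ y ^ 2 * B := by positivity
    have h₃ : 0 ≤ (4 * p + 16 * p / (p - 1)) * a⁻¹ * y := by positivity
    linarith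
end

section
/- Let p ∈ (1,∞) and a > 0, and define H_a(y) = y²·G_a(y/a) for 0 < y ≤ a. Then H_a is continuous on (0,a], positive on (0,a), H_a(a) = 0, and H_a satisfies the differential equation H_a'(y) = −(8p·y²·(1+2y) + (2p + 4(3p−4)·y)·H_a(y)) / (4y² + (p−1)·H_a(y)) for 0 < y < a. Moreover, the limit L = lim_{y→0⁺} H_a(y) exists, is finite and positive, and H_a extends to an infinitely differentiable function on some open interval containing [0,a] which is positive on [0,a). -/
open Set Real Filter MeasureTheory

/-- `H_a(y) = y² G_a(y/a)`. -/
noncomputable def Ha (G : ℝ → ℝ → ℝ) (a y : ℝ) : ℝ := y^2 * G a (y/a)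

/-- `g(t) = ∫_t^a H_a(w)^{-1/2} dw`. -/
noncomputable def gfun (G : ℝ → ℝ → ℝ) (a t : ℝ) : ℝ :=
  ∫ w in Set.Ioo t a, (Real.sqrt (Ha G a w))⁻¹

/-- `θ_a = ∫_0^a H_a(w)^{-1/2} dw`. -/
noncomputable def thetaA (G : ℝ → ℝ → ℝ) (a : ℝ) : ℝ := gfun G a 0

open scoped Topology

/-- A scalar non-autonomous equation `u' = f (t, u)` with `C¹` right-hand side has a local solution
through every point. -/
theorem exists_local_solution {f : ℝ × ℝ → ℝ} {c x : ℝ} (hf : ContDiffAt ℝ 1 f (c, x)) :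
    ∃ u : ℝ → ℝ, u c = x ∧ ∃ ε > 0, ∀ t ∈ Ioo (c - ε) (c + ε), HasDerivAt u (f (t, u t)) t := by
  have hv : ContDiffAt ℝ 1 (fun z : ℝ × ℝ => ((1 : ℝ), f z)) (c, x) := contDiffAt_const.prodMk hf
  obtain ⟨α, hα, ε, hε, hd⟩ :=
    hv.exists_forall_mem_closedBall_exists_eq_forall_mem_Ioo_hasDerivAt₀ c
  have hfst (t : ℝ) (ht : t ∈ Ioo (c - ε) (c + ε)) : HasDerivAt (fun s => (α s).1) 1 t :=
    (hasFDerivAt_fst (𝕜 := ℝ) (p := α t)).comp_hasDerivAt t (hd t ht)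
  have hsnd (t : ℝ) (ht : t ∈ Ioo (c - ε) (c + ε)) :
      HasDerivAt (fun s => (α s).2) (f (α t)) t :=
    (hasFDerivAt_snd (𝕜 := ℝ) (p := α t)).comp_hasDerivAt t (hd t ht)
  have hsub (t : ℝ) (ht : t ∈ Ioo (c - ε) (c + ε)) :
      HasDerivAt (fun s => (α s).1 - s) 0 t := by
    simpa using (hfst t ht).fun_sub (hasDerivAt_id' t)
  have htime (t : ℝ) (ht : t ∈ Ioo (c - ε) (c + ε)) : (α t).1 = t := by
    have h := isOpen_Ioo.is_const_of_deriv_eq_zero isPreconnected_Ioo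
      (fun s hs => (hsub s hs).differentiableAt.differentiableWithinAt)
      (fun s hs => (hsub s hs).deriv) ht
      (show c ∈ Ioo (c - ε) (c + ε) from ⟨by linarith, by linarith⟩)
    simp only [hα] at h
    linarith
  refine ⟨fun t => (α t).2, by simp [hα], ε, hε, fun t ht => ?_⟩
  have h : α t = (t, (α t).2) := Prod.ext (htime t ht) rfl
  have h' := hsnd t ht
  rwa [h] at h'

/-- A continuous function solving `u' = f (t, u)` in a punctured neighbourhood of `c` solves it
at `c` as well. -/
theorem hasDerivAt_of_punctured_solution {f : ℝ × ℝ → ℝ} {u : ℝ → ℝ} {c : ℝ}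
    (hu : ContinuousAt u c) (hf : ContinuousAt f (c, u c))
    (hd : ∀ᶠ t in 𝓝[≠] c, HasDerivAt u (f (t, u t)) t) : HasDerivAt u (f (c, u c)) c := by
  have hlim : Tendsto (deriv u) (𝓝[≠] c) (𝓝 (f (c, u c))) := by
    have hg : ContinuousAt (fun t => f (t, u t)) c :=
      ContinuousAt.comp (f := fun t => (t, u t)) hf (continuousAt_id.prodMk hu)
    exact (hg.tendsto.mono_left nhdsWithin_le_nhds).congr' (hd.mono fun t ht => ht.deriv.symm)
  have hdiff : DifferentiableOn ℝ u {t | HasDerivAt u (f (t, u t)) t} :=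
    fun t ht => HasDerivAt.differentiableAt ht |>.differentiableWithinAt
  have hr : HasDerivWithinAt u (f (c, u c)) (Ici c) c :=
    hasDerivWithinAt_Ici_of_tendsto_deriv hdiff hu.continuousWithinAt
      (nhdsGT_le_nhdsNE c hd) (hlim.mono_left (nhdsGT_le_nhdsNE c))
  have hl : HasDerivWithinAt u (f (c, u c)) (Iic c) c :=
    hasDerivWithinAt_Iic_of_tendsto_deriv hdiff hu.continuousWithinAt
      (nhdsLT_le_nhdsNE c hd) (hlim.mono_left (nhdsLT_le_nhdsNE c))
  simpa using hl.union hr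

/-- A solution of `u' = f (t, u)` is smooth where `f` is smooth. -/
theorem contDiffOn_infty_of_solution {f : ℝ × ℝ → ℝ} {u : ℝ → ℝ} {s : Set ℝ} (hs : IsOpen s)
    (hf : ∀ t ∈ s, ContDiffAt ℝ (⊤ : ℕ∞) f (t, u t))
    (hd : ∀ t ∈ s, HasDerivAt u (f (t, u t)) t) : ContDiffOn ℝ (⊤ : ℕ∞) u s := by
  refine contDiffOn_infty.2 fun n => ?_
  induction n with
  | zero =>
    exact contDiffOn_zero.2 fun t ht => (hd t ht).continuousAt.continuousWithinAt
  | succ n ih =>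
    push_cast
    refine (contDiffOn_succ_iff_deriv_of_isOpen hs).2
      ⟨fun t ht => (hd t ht).differentiableAt.differentiableWithinAt, by simp, ?_⟩
    have h : ContDiffOn ℝ n (fun t => f (t, u t)) s := fun t ht =>
      ContDiffAt.comp_contDiffWithinAt (f := fun t => (t, u t)) t
        ((hf t ht).of_le (by exact_mod_cast le_top)) (contDiffWithinAt_id.prodMk (ih t ht))
    exact h.congr fun t ht => (hd t ht).deriv

/-- The right-hand side of the differential equation satisfied by `H_a`. -/
noncomputable def HaField (p : ℝ) (z : ℝ × ℝ) : ℝ :=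
  -((8*p*z.1^2*(1 + 2*z.1) + (2*p + 4*(3*p - 4)*z.1) * z.2) / (4*z.1^2 + (p - 1) * z.2))

theorem contDiffAt_HaField {n : WithTop ℕ∞} {p : ℝ} {z : ℝ × ℝ}
    (hz : 4*z.1^2 + (p - 1) * z.2 ≠ 0) : ContDiffAt ℝ n (HaField p) z := by
  have hnum : ContDiffAt ℝ n
      (fun z : ℝ × ℝ => 8*p*z.1^2*(1 + 2*z.1) + (2*p + 4*(3*p - 4)*z.1) * z.2) z := by fun_prop
  have hden : ContDiffAt ℝ n (fun z : ℝ × ℝ => 4*z.1^2 + (p - 1) * z.2) z := by fun_prop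
  exact (hnum.div hden hz).neg

theorem hasDerivAt_Ha {p a : ℝ} (hp : 1 < p) (ha : 0 < a) {G : ℝ → ℝ → ℝ} (hG : IsGFamily p G)
    {y : ℝ} (hy : y ∈ Ioo 0 a) : HasDerivAt (Ha G a) (HaField p (y, Ha G a y)) y := by
  obtain ⟨-, -, hd, hpos, -⟩ := hG a ha
  have hy0 : 0 < y := hy.1
  have hya : y / a ∈ Ioo (0 : ℝ) 1 := ⟨by positivity, (div_lt_one ha).2 hy.2⟩
  have hcomp : HasDerivAt (fun y => G a (y / a)) (-(Fa p a (y / a) (G a (y / a))) * (1 / a)) y :=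
    HasDerivAt.comp y (hd _ hya) ((hasDerivAt_id y).div_const a)
  have hH := ((hasDerivAt_id y).pow 2).mul hcomp
  have hw := hpos _ hya
  refine hH.congr_deriv ?_
  simp only [HaField, Ha, Fa, id, Pi.pow_apply]
  generalize G a (y / a) = w at hw
  have hp' : 0 < p - 1 := by linarith
  have h1 : 4 + (p - 1) * w ≠ 0 := by positivity
  have h2 : 4 * y ^ 2 + (p - 1) * (y ^ 2 * w) ≠ 0 := by positivity
  field_simp
  ring

theorem Ha_pos {p a : ℝ} (ha : 0 < a) {G : ℝ → ℝ → ℝ} (hG : IsGFamily p G) {y : ℝ}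
    (hy : y ∈ Ioo 0 a) : 0 < Ha G a y := by
  obtain ⟨-, -, -, hpos, -⟩ := hG a ha
  have hy0 : 0 < y := hy.1
  exact mul_pos (by positivity) (hpos _ ⟨by positivity, (div_lt_one ha).2 hy.2⟩)

theorem Ha_self {p a : ℝ} (ha : 0 < a) {G : ℝ → ℝ → ℝ} (hG : IsGFamily p G) : Ha G a a = 0 := by
  simp [Ha, div_self ha.ne', (hG a ha).2.1]

theorem continuousOn_Ha {p a : ℝ} (ha : 0 < a) {G : ℝ → ℝ → ℝ} (hG : IsGFamily p G) :
    ContinuousOn (Ha G a) (Ioc 0 a) := by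
  refine ContinuousOn.mul (by fun_prop) ?_
  refine (hG a ha).1.comp (by fun_prop) fun y hy => ?_
  exact ⟨div_pos hy.1 ha, (div_le_one ha).2 hy.2⟩

theorem exists_tendsto_Ha {p a : ℝ} (hp : 1 < p) (ha : 0 < a) {G : ℝ → ℝ → ℝ}
    (hG : IsGFamily p G) : ∃ L : ℝ, 0 < L ∧ Tendsto (Ha G a) (𝓝[>] 0) (𝓝 L) := by
  have hp' : 0 < p - 1 := by linarith
  obtain ⟨r, hr, hra, hr8⟩ : ∃ r : ℝ, 0 < r ∧ r < a ∧ r ≤ 1 / 8 :=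
    ⟨min (a / 2) (1 / 8), by positivity, by linarith [min_le_left (a / 2) (1 / 8)],
      min_le_right _ _⟩
  set C : ℝ := 4 * p + 4 * p / (p - 1) with hC
  have hCp : C * (p - 1) = 4 * p * (p - 1) + 4 * p := by rw [hC]; field_simp
  have hC4 : 4 * p ≤ C := le_add_of_nonneg_right (by positivity)
  have hmem {y : ℝ} (hy : y ∈ Ioc 0 r) : y ∈ Ioo 0 a := ⟨hy.1, hy.2.trans_lt hra⟩
  have hd {y : ℝ} (hy : y ∈ Ioc 0 r) := hasDerivAt_Ha hp ha hG (hmem hy)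
  have hcont : ContinuousOn (Ha G a) (Ioc 0 r) :=
    fun y hy => (hd hy).continuousAt.continuousWithinAt
  have hcoef {y : ℝ} (hy : y ∈ Ioc 0 r) : 0 ≤ 2*p + 4*(3*p - 4)*y ∧ 2*p + 4*(3*p - 4)*y ≤ 4*p := by
    have h1 := hy.1
    have h2 : y ≤ 1 / 8 := hy.2.trans hr8
    constructor <;> nlinarith
  have hneg {y : ℝ} (hy : y ∈ Ioc 0 r) : HaField p (y, Ha G a y) ≤ 0 := by
    have h1 := hy.1
    have h2 := (hcoef hy).1
    have h3 := Ha_pos ha hG (hmem hy)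
    simp only [HaField]
    rw [neg_nonpos]
    positivity
  have hlow {y : ℝ} (hy : y ∈ Ioc 0 r) : 0 ≤ HaField p (y, Ha G a y) + C := by
    have h1 := hy.1
    have h2 := (hcoef hy).2
    have h3 := Ha_pos ha hG (hmem hy)
    have h4 : y ≤ 1 / 8 := hy.2.trans hr8
    have h5 : (8*p*y^2*(1 + 2*y) + (2*p + 4*(3*p - 4)*y) * Ha G a y)
        / (4*y^2 + (p - 1) * Ha G a y) ≤ C := by
      rw [div_le_iff₀ (by positivity)]
      have h6 : 8*p*y^2*(1 + 2*y) ≤ C * (4*y^2) := by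
        have : 8*p*y^2*(1 + 2*y) ≤ 8*p*y^2*2 := by gcongr; linarith
        nlinarith [mul_le_mul_of_nonneg_right hC4 (sq_nonneg y)]
      have h7 : (2*p + 4*(3*p - 4)*y) * Ha G a y ≤ C * ((p - 1) * Ha G a y) := by
        rw [← mul_assoc, hCp]
        refine mul_le_mul_of_nonneg_right (h2.trans ?_) h3.le
        nlinarith
      linarith
    simp only [HaField]
    linarith
  have hanti : AntitoneOn (Ha G a) (Ioc 0 r) := by
    refine antitoneOn_of_deriv_nonpos (convex_Ioc 0 r) hcont (fun y hy => ?_) fun y hy => ?_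
    · exact (hd (interior_subset hy)).differentiableAt.differentiableWithinAt
    · rw [(hd (interior_subset hy)).deriv]
      exact hneg (interior_subset hy)
  have hmono : MonotoneOn (fun y => Ha G a y + C * y) (Ioc 0 r) := by
    have hd' {y : ℝ} (hy : y ∈ Ioc 0 r) :
        HasDerivAt (fun y => Ha G a y + C * y) (HaField p (y, Ha G a y) + C) y := by
      simpa using (hd hy).fun_add ((hasDerivAt_id' y).const_mul C)
    refine monotoneOn_of_deriv_nonneg (convex_Ioc 0 r) (by fun_prop) (fun y hy => ?_)
      fun y hy => ?_
    · exact (hd' (interior_subset hy)).differentiableAt.differentiableWithinAt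
    · rw [(hd' (interior_subset hy)).deriv]
      exact hlow (interior_subset hy)
  have hrr : r ∈ Ioc 0 r := ⟨hr, le_rfl⟩
  have hlim := (hanti.mono Ioo_subset_Ioc_self).tendsto_nhdsWithin_Ioo_right
    (nonempty_Ioo.2 hr) ⟨Ha G a r + C * r, by
      rintro _ ⟨y, hy, rfl⟩
      have h1 := hmono (Ioo_subset_Ioc_self hy) hrr hy.2.le
      have h2 : 0 ≤ C * y := mul_nonneg (by linarith) hy.1.le
      simp only at h1
      linarith⟩
  refine ⟨_, (Ha_pos ha hG (hmem hrr)).trans_le (ge_of_tendsto hlim ?_), hlim⟩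
  filter_upwards [Ioo_mem_nhdsGT hr] with y hy
  exact hanti (Ioo_subset_Ioc_self hy) hrr hy.2.le

theorem exists_smooth_extension_Ha {p a L : ℝ} (hp : 1 < p) (ha : 0 < a) {G : ℝ → ℝ → ℝ}
    (hG : IsGFamily p G) (hL : 0 < L) (hlim : Tendsto (Ha G a) (𝓝[>] 0) (𝓝 L)) :
    ∃ (H : ℝ → ℝ) (δ : ℝ), 0 < δ ∧ ContDiffOn ℝ (⊤ : ℕ∞) H (Ioo (-δ) (a + δ)) ∧
      EqOn H (Ha G a) (Ioc 0 a) ∧ ∀ y ∈ Ico 0 a, 0 < H y := by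
  have hp' : 0 < p - 1 := by linarith
  have hD0 : 4 * (0 : ℝ)^2 + (p - 1) * L ≠ 0 := by positivity
  have hDa : 4 * a^2 + (p - 1) * 0 ≠ 0 := by positivity
  obtain ⟨u, hu0, ε, hε, hu⟩ := exists_local_solution (contDiffAt_HaField (p := p) (z := (0, L)) hD0)
  obtain ⟨v, hva, η, hη, hv⟩ := exists_local_solution (contDiffAt_HaField (p := p) (z := (a, 0)) hDa)
  set H : ℝ → ℝ := fun y => if y ≤ 0 then u y else if y ≤ a then Ha G a y else v y with hH
  have hHu {y : ℝ} (hy : y ≤ 0) : H y = u y := if_pos hy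
  have hHm {y : ℝ} (hy : y ∈ Ioc 0 a) : H y = Ha G a y := by
    simp [hH, not_le.2 hy.1, hy.2]
  have hHv {y : ℝ} (hy : a < y) : H y = v y := by
    simp [hH, not_le.2 hy, not_le.2 (ha.trans hy)]
  have hH0 : H 0 = L := (hHu le_rfl).trans hu0
  have hHa : H a = 0 := (hHm ⟨ha, le_rfl⟩).trans (Ha_self ha hG)
  have hneg : ∀ y ∈ Ioo (-ε) 0, HasDerivAt H (HaField p (y, H y)) y := by
    intro y hy
    rw [hHu hy.2.le]
    refine (hu y ⟨by linarith [hy.1], by linarith [hy.2]⟩).congr_of_eventuallyEq ?_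
    filter_upwards [Iio_mem_nhds hy.2] with t ht using hHu (le_of_lt ht)
  have hmid : ∀ y ∈ Ioo 0 a, HasDerivAt H (HaField p (y, H y)) y := by
    intro y hy
    rw [hHm (Ioo_subset_Ioc_self hy)]
    refine (hasDerivAt_Ha hp ha hG hy).congr_of_eventuallyEq ?_
    filter_upwards [Ioo_mem_nhds hy.1 hy.2] with t ht using hHm (Ioo_subset_Ioc_self ht)
  have hright : ∀ y ∈ Ioo a (a + η), HasDerivAt H (HaField p (y, H y)) y := by
    intro y hy
    rw [hHv hy.1]
    refine (hv y ⟨by linarith [hy.1], hy.2⟩).congr_of_eventuallyEq ?_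
    filter_upwards [Ioi_mem_nhds hy.1] with t ht using hHv ht
  have hcont0 : ContinuousAt H 0 := by
    refine continuousAt_iff_continuous_left'_right'.2 ⟨?_, ?_⟩
    · exact (hu 0 ⟨by linarith, by linarith⟩).continuousAt.continuousWithinAt.congr
        (fun y hy => hHu (le_of_lt hy)) (hHu le_rfl)
    · rw [ContinuousWithinAt, hH0]
      refine hlim.congr' ?_
      filter_upwards [Ioo_mem_nhdsGT ha] with y hy using (hHm (Ioo_subset_Ioc_self hy)).symm
  have hconta : ContinuousAt H a := by
    refine continuousAt_iff_continuous_left'_right'.2 ⟨?_, ?_⟩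
    · have h : ContinuousWithinAt H (Ioc 0 a) a :=
        (continuousOn_Ha ha hG a ⟨ha, le_rfl⟩).congr (fun y hy => hHm hy) (hHm ⟨ha, le_rfl⟩)
      exact h.mono_of_mem_nhdsWithin (mem_of_superset (Ioo_mem_nhdsLT ha) Ioo_subset_Ioc_self)
    · exact (hv a ⟨by linarith, by linarith⟩).continuousAt.continuousWithinAt.congr
        (fun y hy => hHv hy) (hHa.trans hva.symm)
  have hder0 : HasDerivAt H (HaField p (0, H 0)) 0 := by
    refine hasDerivAt_of_punctured_solution hcont0
      (contDiffAt_HaField (n := 0) (by simpa only [hH0] using hD0)).continuousAt ?_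
    filter_upwards [self_mem_nhdsWithin,
      mem_nhdsWithin_of_mem_nhds (Ioo_mem_nhds (neg_lt_zero.2 hε) ha)] with y hy hy'
    rcases lt_or_gt_of_ne hy with h | h
    · exact hneg y ⟨hy'.1, h⟩
    · exact hmid y ⟨h, hy'.2⟩
  have hdera : HasDerivAt H (HaField p (a, H a)) a := by
    refine hasDerivAt_of_punctured_solution hconta
      (contDiffAt_HaField (n := 0) (by simpa only [hHa] using hDa)).continuousAt ?_
    filter_upwards [self_mem_nhdsWithin,
      mem_nhdsWithin_of_mem_nhds (Ioo_mem_nhds ha (lt_add_of_pos_right a hη))] with y hy hy'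
    rcases lt_or_gt_of_ne hy with h | h
    · exact hmid y ⟨hy'.1, h⟩
    · exact hright y ⟨h, hy'.2⟩
  have hne0 : ∀ᶠ y in 𝓝 (0 : ℝ), 4*y^2 + (p - 1) * H y ≠ 0 := by
    have h : ContinuousAt (fun y => 4*y^2 + (p - 1) * H y) 0 := by fun_prop
    exact h.eventually_ne (by simpa only [hH0] using hD0)
  have hnea : ∀ᶠ y in 𝓝 a, 4*y^2 + (p - 1) * H y ≠ 0 := by
    have h : ContinuousAt (fun y => 4*y^2 + (p - 1) * H y) a := by fun_prop
    exact h.eventually_ne (by simpa only [hHa] using hDa)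
  obtain ⟨δ₀, hδ₀, h0⟩ := Metric.eventually_nhds_iff.1 hne0
  obtain ⟨δ₁, hδ₁, h1⟩ := Metric.eventually_nhds_iff.1 hnea
  obtain ⟨δ, hδ, hδε, hδη, hδδ₀, hδδ₁⟩ :
      ∃ δ : ℝ, 0 < δ ∧ δ ≤ ε ∧ δ ≤ η ∧ δ ≤ δ₀ ∧ δ ≤ δ₁ :=
    ⟨min (min ε η) (min δ₀ δ₁), by positivity, by simp, by simp, by simp, by simp⟩
  have hposm {y : ℝ} (hy : y ∈ Ioo 0 a) : 0 < H y := by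
    rw [hHm (Ioo_subset_Ioc_self hy)]
    exact Ha_pos ha hG hy
  refine ⟨H, δ, hδ, ?_, fun y hy => hHm hy, fun y hy => ?_⟩
  · refine contDiffOn_infty_of_solution (f := HaField p) isOpen_Ioo (fun y hy => ?_) fun y hy => ?_
    · refine contDiffAt_HaField ?_
      rcases le_or_gt y 0 with h | h
      · exact h0 (by rw [Real.dist_eq, sub_zero, abs_of_nonpos h]; linarith [hy.1])
      rcases lt_or_ge y a with h' | h'
      · have := hposm ⟨h, h'⟩
        positivity
      · exact h1 (by rw [Real.dist_eq, abs_of_nonneg (by linarith)]; linarith [hy.2])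
    · rcases lt_trichotomy y 0 with h | rfl | h
      · exact hneg y ⟨by linarith [hy.1], h⟩
      · exact hder0
      rcases lt_trichotomy y a with h' | rfl | h'
      · exact hmid y ⟨h, h'⟩
      · exact hdera
      · exact hright y ⟨h', by linarith [hy.2]⟩
  · rcases hy.1.eq_or_lt with rfl | h
    · rwa [hH0]
    · exact hposm ⟨h, hy.2⟩

theorem Ha_properties (p a : ℝ) (hp : 1 < p) (ha : 0 < a) (G : ℝ → ℝ → ℝ)
    (hG : IsGFamily p G) :
    ContinuousOn (Ha G a) (Set.Ioc 0 a) ∧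
    (∀ y ∈ Set.Ioo 0 a, 0 < Ha G a y) ∧
    Ha G a a = 0 ∧
    (∀ y ∈ Set.Ioo 0 a, HasDerivAt (Ha G a)
      (-((8*p*y^2*(1 + 2*y) + (2*p + 4*(3*p - 4)*y) * Ha G a y)
          / (4*y^2 + (p - 1) * Ha G a y))) y) ∧
    (∃ L : ℝ, 0 < L ∧
      Filter.Tendsto (Ha G a) (nhdsWithin 0 (Set.Ioi 0)) (nhds L)) ∧
    (∃ (H : ℝ → ℝ) (δ : ℝ), 0 < δ ∧
      ContDiffOn ℝ (⊤ : ℕ∞) H (Set.Ioo (-δ) (a + δ)) ∧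
      Set.EqOn H (Ha G a) (Set.Ioc 0 a) ∧
      ∀ y ∈ Set.Ico 0 a, 0 < H y) := by
  obtain ⟨L, hL, hlim⟩ := exists_tendsto_Ha hp ha hG
  exact ⟨continuousOn_Ha ha hG, fun y hy => Ha_pos ha hG hy, Ha_self ha hG,
    fun y hy => hasDerivAt_Ha hp ha hG hy, ⟨L, hL, hlim⟩,
    exists_smooth_extension_Ha hp ha hG hL hlim⟩
end

section
/- Let p ∈ (1,∞). The map a ↦ θ_a is continuous and strictly increasing on (0,∞), and for every a > 0 one has θ_a = ∫₀¹ du / (u·√(G_a(u))). -/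
open Set Real Filter MeasureTheory

open scoped Topology

/-- Difference of `Fa` in its last variable, as an explicit multiple of the increment. -/
lemma Fa_sub_Fa_right {p a y w v : ℝ} (hp : 1 < p) (hy : 0 < y) (hw : 0 ≤ w) (hv : 0 ≤ v) :
    Fa p a y w - Fa p a y v =
      (2 / y + (8 * p * (1 / a) + (48 * p - 64) * y - 8 * p * (p - 1) * (1 / a + 2 * y)) /
        (y ^ 2 * ((4 + (p - 1) * w) * (4 + (p - 1) * v)))) * (w - v) := by
  have hq : 0 < p - 1 := by linarith
  have hw' : 4 + (p - 1) * w ≠ 0 := by positivity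
  have hv' : 4 + (p - 1) * v ≠ 0 := by positivity
  have hs : 2 * p / a = 2 * p * (1 / a) := by ring
  unfold Fa
  rw [hs]
  generalize 1 / a = s
  field_simp
  ring

/-- Difference of `Fa` in the parameter `a`. -/
lemma Fa_sub_Fa_param {p a b y w : ℝ} (hp : 1 < p) (hy : 0 < y) (hw : 0 ≤ w) :
    Fa p a y w - Fa p b y w =
      2 * p * (4 + w) / (y ^ 2 * (4 + (p - 1) * w)) * (1 / a - 1 / b) := by
  have hq : 0 < p - 1 := by linarith
  have hw' : 4 + (p - 1) * w ≠ 0 := by positivity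
  have hs : 2 * p / a = 2 * p * (1 / a) := by ring
  have hs' : 2 * p / b = 2 * p * (1 / b) := by ring
  unfold Fa
  rw [hs, hs']
  generalize 1 / a = s
  generalize 1 / b = t
  field_simp
  ring

lemma Fa_lt_Fa_of_lt {p a b y w : ℝ} (hp : 1 < p) (ha : 0 < a) (hab : a < b) (hy : 0 < y)
    (hw : 0 ≤ w) : Fa p b y w < Fa p a y w := by
  have hq : 0 < p - 1 := by linarith
  have hs : 0 < 1 / a - 1 / b := sub_pos.2 (one_div_lt_one_div_of_lt ha hab)
  rw [← sub_pos, Fa_sub_Fa_param hp hy hw]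
  positivity

lemma Fa_sub_Fa_param_le {p a b y₀ y w : ℝ} (hp : 1 < p) (ha : 0 < a) (hab : a ≤ b)
    (hy₀ : 0 < y₀) (hy : y₀ ≤ y) (hw : 0 ≤ w) :
    Fa p a y w - Fa p b y w ≤ 2 * p * (1 + 1 / (p - 1)) / y₀ ^ 2 * (1 / a - 1 / b) := by
  have hq : 0 < p - 1 := by linarith
  have hs : 0 ≤ 1 / a - 1 / b := sub_nonneg.2 (one_div_le_one_div_of_le ha hab)
  have hy' : 0 < y := hy₀.trans_le hy
  rw [Fa_sub_Fa_param hp hy' hw]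
  refine mul_le_mul_of_nonneg_right ?_ hs
  have h4 : 0 < 4 + (p - 1) * w := by positivity
  have key : (4 + w) / (4 + (p - 1) * w) ≤ 1 + 1 / (p - 1) := by
    rw [div_le_iff₀ h4]
    have : (1 + 1 / (p - 1)) * (4 + (p - 1) * w) = 4 + w + ((p - 1) * w + 4 / (p - 1)) := by
      field_simp
      ring
    rw [this]
    have : 0 ≤ (p - 1) * w + 4 / (p - 1) := by positivity
    linarith
  calc 2 * p * (4 + w) / (y ^ 2 * (4 + (p - 1) * w))
      = 2 * p * ((4 + w) / (4 + (p - 1) * w)) / y ^ 2 := by field_simp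
    _ ≤ 2 * p * (1 + 1 / (p - 1)) / y₀ ^ 2 := by gcongr

/-- `Fa` is Lipschitz in its last variable, uniformly for `y` and `a` away from `0`. -/
lemma exists_Fa_lipschitz {p c y₀ : ℝ} (hp : 1 < p) (hc : 0 < c) (hy₀ : 0 < y₀) :
    ∃ L : ℝ, 0 < L ∧ ∀ a, c ≤ a → ∀ y ∈ Icc y₀ 1, ∀ w v : ℝ, 0 ≤ w → 0 ≤ v →
      |Fa p a y w - Fa p a y v| ≤ L * |w - v| := by
  have hq : 0 < p - 1 := by linarith
  refine ⟨2 / y₀ + (8 * p * (1 / c) + (48 * p + 64) + 8 * p * (p - 1) * (1 / c + 2)) / y₀ ^ 2,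
    by positivity, ?_⟩
  intro a hca y hy w v hw hv
  have ha : 0 < a := hc.trans_le hca
  have hy' : 0 < y := hy₀.trans_le hy.1
  have hs : 1 / a ≤ 1 / c := one_div_le_one_div_of_le hc hca
  have hs0 : 0 < 1 / a := by positivity
  rw [Fa_sub_Fa_right hp hy' hw hv, abs_mul]
  refine mul_le_mul_of_nonneg_right ?_ (abs_nonneg _)
  refine (abs_add_le _ _).trans (add_le_add ?_ ?_)
  · rw [abs_of_pos (by positivity)]
    exact div_le_div_of_nonneg_left (by norm_num) hy₀ hy.1
  · have hden : y₀ ^ 2 ≤ y ^ 2 * ((4 + (p - 1) * w) * (4 + (p - 1) * v)) := by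
      have h1 : y₀ ^ 2 ≤ y ^ 2 := pow_le_pow_left₀ hy₀.le hy.1 2
      have hwq : 0 ≤ (p - 1) * w := by positivity
      have hvq : 0 ≤ (p - 1) * v := by positivity
      have h2 : 1 ≤ (4 + (p - 1) * w) * (4 + (p - 1) * v) := by nlinarith
      nlinarith [sq_nonneg y]
    rw [abs_div, abs_of_pos (a := y ^ 2 * _) (by positivity)]
    refine div_le_div₀ (by positivity) ?_ (by positivity) hden
    generalize 1 / a = s at *
    generalize 1 / c = t at *
    have h1 : 8 * p * s ≤ 8 * p * t := by gcongr
    have h1' : 0 ≤ 8 * p * s := by positivity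
    have h2 : 8 * p * (p - 1) * (s + 2 * y) ≤ 8 * p * (p - 1) * (t + 2) := by
      have := hy.2
      gcongr
      linarith
    have h2' : 0 ≤ 8 * p * (p - 1) * (s + 2 * y) := by positivity
    have h3 : p * y ≤ p := by nlinarith [hy.2]
    have h3' : 0 ≤ p * y := by positivity
    rw [abs_le]
    constructor <;> nlinarith [hy.2]

/-- A function with negative derivative takes smaller values arbitrarily close to the right. -/
lemma exists_mem_Ioo_lt_of_hasDerivAt_neg {f : ℝ → ℝ} {f' x z : ℝ} (hf : HasDerivAt f f' x)
    (hf' : f' < 0) (hxz : x < z) : ∃ y ∈ Ioo x z, f y < f x := by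
  have h1 : ∀ᶠ y in 𝓝[>] x, slope f x y < 0 :=
    ((hasDerivAt_iff_tendsto_slope.1 hf).mono_left
      (nhdsWithin_mono x fun y hy => ne_of_gt hy)).eventually (gt_mem_nhds hf')
  obtain ⟨y, hy, hyz⟩ := (h1.and (Ioo_mem_nhdsGT hxz)).exists
  refine ⟨y, hyz, ?_⟩
  rw [slope_def_field, div_lt_iff₀ (sub_pos.2 hyz.1)] at hy
  linarith

section Family

variable {p : ℝ} {G : ℝ → ℝ → ℝ}

lemma IsGFamily.continuousOn (hG : IsGFamily p G) {a : ℝ} (ha : 0 < a) :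
    ContinuousOn (G a) (Ioc 0 1) := (hG a ha).1

lemma IsGFamily.apply_one (hG : IsGFamily p G) {a : ℝ} (ha : 0 < a) : G a 1 = 0 :=
  (hG a ha).2.1

lemma IsGFamily.hasDerivAt (hG : IsGFamily p G) {a y : ℝ} (ha : 0 < a) (hy : y ∈ Ioo (0 : ℝ) 1) :
    HasDerivAt (G a) (-(Fa p a y (G a y))) y := (hG a ha).2.2.1 y hy

lemma IsGFamily.pos (hG : IsGFamily p G) {a y : ℝ} (ha : 0 < a) (hy : y ∈ Ioo (0 : ℝ) 1) :
    0 < G a y := (hG a ha).2.2.2.1 y hy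

/-- Comparison principle: `G a` strictly decreases in `a`. -/
lemma IsGFamily.lt_of_lt (hp : 1 < p) (hG : IsGFamily p G) {a b u : ℝ} (ha : 0 < a) (hab : a < b)
    (hu : u ∈ Ioo (0 : ℝ) 1) : G b u < G a u := by
  have hb : 0 < b := ha.trans hab
  obtain ⟨L, -, hL⟩ := exists_Fa_lipschitz hp ha hu.1
  by_contra! hle
  let ψ : ℝ → ℝ := fun y => Real.exp (L * y) * (G a y - G b y)
  have hψ1 : ψ 1 = 0 := by simp [ψ, hG.apply_one ha, hG.apply_one hb]
  have hψu : ψ u ≤ 0 := mul_nonpos_of_nonneg_of_nonpos (exp_pos _).le (by linarith)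
  have hsub : Icc u 1 ⊆ Ioc (0 : ℝ) 1 := fun y hy => ⟨hu.1.trans_le hy.1, hy.2⟩
  have hcont : ContinuousOn ψ (Icc u 1) :=
    (by fun_prop : Continuous fun y : ℝ => Real.exp (L * y)).continuousOn.mul
      (((hG.continuousOn ha).mono hsub).sub ((hG.continuousOn hb).mono hsub))
  obtain ⟨m, hm, hmin, hm1⟩ : ∃ m ∈ Icc u 1, IsMinOn ψ (Icc u 1) m ∧ m < 1 := by
    obtain ⟨m, hm, hmin⟩ := isCompact_Icc.exists_isMinOn (nonempty_Icc.2 hu.2.le) hcont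
    rcases hm.2.lt_or_eq with h | h
    · exact ⟨m, hm, hmin, h⟩
    · refine ⟨u, left_mem_Icc.2 hu.2.le, fun y hy => ?_, hu.2⟩
      have := hmin hy
      simp only [mem_ofPred_eq, h, hψ1] at this ⊢
      exact hψu.trans this
  have hm0 : m ∈ Ioo (0 : ℝ) 1 := ⟨hu.1.trans_le hm.1, hm1⟩
  have hψm : ψ m ≤ 0 := le_trans (hmin (left_mem_Icc.2 hu.2.le)) hψu
  have hD : G a m - G b m ≤ 0 := nonpos_of_mul_nonpos_right hψm (exp_pos _)
  have hder : HasDerivAt ψ (Real.exp (L * m) * (L * 1) * (G a m - G b m) +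
      Real.exp (L * m) * (-(Fa p a m (G a m)) - -(Fa p b m (G b m)))) m :=
    (((hasDerivAt_id m).const_mul L).exp).mul ((hG.hasDerivAt ha hm0).sub (hG.hasDerivAt hb hm0))
  have hneg : Real.exp (L * m) * (L * 1) * (G a m - G b m) +
      Real.exp (L * m) * (-(Fa p a m (G a m)) - -(Fa p b m (G b m))) < 0 := by
    have h1 := hL a le_rfl m hm _ _ (hG.pos ha hm0).le (hG.pos hb hm0).le
    rw [abs_of_nonpos hD] at h1
    have h2 := Fa_lt_Fa_of_lt hp ha hab hm0.1 (hG.pos hb hm0).le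
    have h3 := (abs_le.1 h1).1
    have h4 : L * (G a m - G b m) + (-(Fa p a m (G a m)) - -(Fa p b m (G b m))) < 0 := by
      linarith
    have := mul_neg_of_pos_of_neg (exp_pos (L * m)) h4
    linarith
  obtain ⟨y, hy, hlt⟩ := exists_mem_Ioo_lt_of_hasDerivAt_neg hder hneg hm1
  exact absurd (hmin ⟨hm.1.trans hy.1.le, hy.2.le⟩) (not_le.2 hlt)

/-- Quantitative dependence of `G a u` on the parameter `a`. -/
lemma IsGFamily.exists_sub_le (hp : 1 < p) (hG : IsGFamily p G) {c u : ℝ} (hc : 0 < c)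
    (hu : u ∈ Ioo (0 : ℝ) 1) :
    ∃ K : ℝ, ∀ a b, c ≤ a → a < b → G a u - G b u ≤ K * (1 / a - 1 / b) := by
  obtain ⟨L, hL0, hL⟩ := exists_Fa_lipschitz hp hc hu.1
  set C : ℝ := 2 * p * (1 + 1 / (p - 1)) / u ^ 2 with hC
  have hC0 : 0 ≤ C := by
    have hq : 0 < p - 1 := by linarith
    positivity
  refine ⟨Real.exp L * (C / L), fun a b hca hab => ?_⟩
  have ha : 0 < a := hc.trans_le hca
  have hb : 0 < b := ha.trans hab
  set δ : ℝ := 1 / a - 1 / b with hδ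
  have hδ0 : 0 ≤ δ := sub_nonneg.2 (one_div_le_one_div_of_le ha hab.le)
  let φ : ℝ → ℝ := fun y => Real.exp (L * y) * (G a y - G b y + C * δ / L)
  have hsub : Icc u 1 ⊆ Ioc (0 : ℝ) 1 := fun y hy => ⟨hu.1.trans_le hy.1, hy.2⟩
  have hcont : ContinuousOn φ (Icc u 1) :=
    (by fun_prop : Continuous fun y : ℝ => Real.exp (L * y)).continuousOn.mul
      ((((hG.continuousOn ha).mono hsub).sub ((hG.continuousOn hb).mono hsub)).add
        continuousOn_const)
  have hder : ∀ y ∈ Ioo u 1, HasDerivAt φ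
      (Real.exp (L * y) * (L * 1) * (G a y - G b y + C * δ / L) +
      Real.exp (L * y) * (-(Fa p a y (G a y)) - -(Fa p b y (G b y)))) y := fun y hy => by
    have hy0 : y ∈ Ioo (0 : ℝ) 1 := ⟨hu.1.trans hy.1, hy.2⟩
    exact (((hasDerivAt_id y).const_mul L).exp).mul
      (((hG.hasDerivAt ha hy0).sub (hG.hasDerivAt hb hy0)).add_const _)
  have hmono : MonotoneOn φ (Icc u 1) := by
    refine monotoneOn_of_hasDerivWithinAt_nonneg (convex_Icc u 1) hcont
      (fun y hy => (hder y (by rwa [interior_Icc] at hy)).hasDerivWithinAt) fun y hy => ?_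
    rw [interior_Icc] at hy
    have hy0 : y ∈ Ioo (0 : ℝ) 1 := ⟨hu.1.trans hy.1, hy.2⟩
    have h1 := hL a hca y ⟨hy.1.le, hy.2.le⟩ _ _ (hG.pos ha hy0).le (hG.pos hb hy0).le
    rw [abs_of_pos (sub_pos.2 (hG.lt_of_lt hp ha hab hy0))] at h1
    have h2 := Fa_sub_Fa_param_le hp ha hab.le hu.1 hy.1.le (hG.pos hb hy0).le
    rw [← hC, ← hδ] at h2
    have h3 := (abs_le.1 h1).2
    have h4 : 0 ≤ L * (G a y - G b y) + C * δ + (-(Fa p a y (G a y)) - -(Fa p b y (G b y))) := by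
      linarith
    have h5 : Real.exp (L * y) * (L * 1) * (G a y - G b y + C * δ / L) +
        Real.exp (L * y) * (-(Fa p a y (G a y)) - -(Fa p b y (G b y))) = Real.exp (L * y) *
        (L * (G a y - G b y) + C * δ + (-(Fa p a y (G a y)) - -(Fa p b y (G b y)))) := by
      field_simp
    rw [h5]
    positivity
  have hle := hmono (left_mem_Icc.2 hu.2.le) (right_mem_Icc.2 hu.2.le) hu.2.le
  simp only [φ, hG.apply_one ha, hG.apply_one hb, mul_one, sub_self, zero_add] at hle
  have hD : 0 ≤ G a u - G b u := (sub_pos.2 (hG.lt_of_lt hp ha hab hu)).le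
  have hCL : 0 ≤ C * δ / L := by positivity
  have h1 : 1 ≤ Real.exp (L * u) := Real.one_le_exp (mul_nonneg hL0.le hu.1.le)
  have h2 : G a u - G b u + C * δ / L ≤ Real.exp (L * u) * (G a u - G b u + C * δ / L) :=
    le_mul_of_one_le_left (by positivity) h1
  calc G a u - G b u ≤ Real.exp L * (C * δ / L) := by linarith
    _ = Real.exp L * (C / L) * δ := by ring

lemma IsGFamily.continuousAt_param (hp : 1 < p) (hG : IsGFamily p G) {a u : ℝ} (ha : 0 < a)
    (hu : u ∈ Ioo (0 : ℝ) 1) : ContinuousAt (fun x => G x u) a := by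
  obtain ⟨K, hK⟩ := hG.exists_sub_le hp (half_pos ha) hu
  have hbound : ∀ᶠ x in 𝓝 a, ‖G x u - G a u‖ ≤ K * |1 / x - 1 / a| := by
    filter_upwards [lt_mem_nhds (half_lt_self ha)] with x hx
    have hx0 : 0 < x := (half_pos ha).trans hx
    rw [Real.norm_eq_abs]
    rcases lt_trichotomy x a with h | h | h
    · rw [abs_of_pos (sub_pos.2 (hG.lt_of_lt hp hx0 h hu)),
        abs_of_pos (sub_pos.2 (one_div_lt_one_div_of_lt hx0 h))]
      exact hK x a hx.le h
    · simp [h]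
    · rw [abs_sub_comm, abs_sub_comm (1 / x),
        abs_of_pos (sub_pos.2 (hG.lt_of_lt hp ha h hu)),
        abs_of_pos (sub_pos.2 (one_div_lt_one_div_of_lt ha h))]
      exact hK a x (half_lt_self ha).le h
  have hlim : Tendsto (fun x => K * |1 / x - 1 / a|) (𝓝 a) (𝓝 0) := by
    have : ContinuousAt (fun x => K * |1 / x - 1 / a|) a := by
      have := ha.ne'
      fun_prop (disch := assumption)
    simpa [ContinuousAt] using this.tendsto
  exact tendsto_iff_norm_sub_tendsto_zero.2
    (squeeze_zero' (Eventually.of_forall fun x => norm_nonneg _) hbound hlim)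

lemma inv_sqrt_Ha_mul {a u : ℝ} (ha : 0 < a) (hu : 0 ≤ u) :
    (√(Ha G a (a * u)))⁻¹ = a⁻¹ * (u * √(G a u))⁻¹ := by
  rw [Ha, mul_div_cancel_left₀ _ ha.ne', Real.sqrt_mul (sq_nonneg _),
    Real.sqrt_sq (by positivity), mul_assoc, mul_inv]

lemma thetaA_eq_intervalIntegral {a : ℝ} (ha : 0 < a) :
    thetaA G a = ∫ u in (0 : ℝ)..1, (u * √(G a u))⁻¹ := by
  have h1 : thetaA G a = ∫ w in (0 : ℝ)..a, (√(Ha G a w))⁻¹ := by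
    rw [thetaA, gfun, intervalIntegral.integral_of_le ha.le, integral_Ioc_eq_integral_Ioo]
  have h2 := intervalIntegral.mul_integral_comp_mul_left (a := 0) (b := 1)
    (f := fun w => (√(Ha G a w))⁻¹) a
  rw [mul_zero, mul_one] at h2
  rw [h1, ← h2, ← intervalIntegral.integral_const_mul]
  refine intervalIntegral.integral_congr fun u hu => ?_
  rw [uIcc_of_le zero_le_one] at hu
  simp only [inv_sqrt_Ha_mul ha hu.1]
  rw [← mul_assoc, mul_inv_cancel₀ ha.ne', one_mul]

lemma intervalIntegrable_inv_mul_sqrt {a : ℝ} (ha : 0 < a)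
    (h : IntegrableOn (fun w => (√(Ha G a w))⁻¹) (Ioo 0 a)) :
    IntervalIntegrable (fun u => (u * √(G a u))⁻¹) volume 0 1 := by
  have h1 : IntervalIntegrable (fun w => (√(Ha G a w))⁻¹) volume 0 a :=
    (intervalIntegrable_iff_integrableOn_Ioo_of_le ha.le).2 h
  have h2 := (h1.comp_mul_left (c := a)).const_mul a
  rw [zero_div, div_self ha.ne'] at h2
  refine h2.congr fun u hu => ?_
  rw [uIoc_of_le zero_le_one] at hu
  simp only [inv_sqrt_Ha_mul ha hu.1.le]
  rw [← mul_assoc, mul_inv_cancel₀ ha.ne', one_mul]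

lemma IsGFamily.inv_mul_sqrt_lt (hp : 1 < p) (hG : IsGFamily p G) {a b u : ℝ} (ha : 0 < a)
    (hab : a < b) (hu : u ∈ Ioo (0 : ℝ) 1) : (u * √(G a u))⁻¹ < (u * √(G b u))⁻¹ := by
  have hb := hG.pos (ha.trans hab) hu
  have := hu.1
  refine inv_strictAnti₀ (mul_pos this (Real.sqrt_pos.2 hb)) ?_
  exact mul_lt_mul_of_pos_left (Real.sqrt_lt_sqrt hb.le (hG.lt_of_lt hp ha hab hu)) this

lemma IsGFamily.inv_mul_sqrt_le (hp : 1 < p) (hG : IsGFamily p G) {a b u : ℝ} (ha : 0 < a)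
    (hab : a < b) (hu : u ∈ Ioc (0 : ℝ) 1) : (u * √(G a u))⁻¹ ≤ (u * √(G b u))⁻¹ := by
  rcases hu.2.lt_or_eq with h | rfl
  · exact (hG.inv_mul_sqrt_lt hp ha hab ⟨hu.1, h⟩).le
  · simp [hG.apply_one ha, hG.apply_one (ha.trans hab)]

lemma IsGFamily.continuousAt_inv_mul_sqrt (hp : 1 < p) (hG : IsGFamily p G) {a u : ℝ} (ha : 0 < a)
    (hu : u ∈ Ioc (0 : ℝ) 1) : ContinuousAt (fun x => (u * √(G x u))⁻¹) a := by
  rcases hu.2.lt_or_eq with h | rfl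
  · have hu' : u ∈ Ioo (0 : ℝ) 1 := ⟨hu.1, h⟩
    exact (continuousAt_const.mul (hG.continuousAt_param hp ha hu').sqrt).inv₀
      (mul_pos hu.1 (Real.sqrt_pos.2 (hG.pos ha hu'))).ne'
  · refine (continuousAt_const (y := (0 : ℝ))).congr ?_
    filter_upwards [lt_mem_nhds ha] with x hx
    simp [hG.apply_one hx]

end Family

theorem thetaA_continuous_strictMono (p : ℝ) (hp : 1 < p)
    (G : ℝ → ℝ → ℝ) (hG : IsGFamily p G)
    (hfin : ∀ a : ℝ, 0 < a →
      MeasureTheory.IntegrableOn (fun w => (Real.sqrt (Ha G a w))⁻¹) (Set.Ioo 0 a)) :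
    ContinuousOn (thetaA G) (Set.Ioi 0) ∧
    StrictMonoOn (thetaA G) (Set.Ioi 0) ∧
    (∀ a ∈ Set.Ioi (0:ℝ),
      thetaA G a = ∫ u in Set.Ioo (0:ℝ) 1, (u * Real.sqrt (G a u))⁻¹) := by
  have hint : ∀ a : ℝ, 0 < a → IntervalIntegrable (fun u => (u * √(G a u))⁻¹) volume 0 1 :=
    fun a ha => intervalIntegrable_inv_mul_sqrt ha (hfin a ha)
  refine ⟨fun a ha => ContinuousAt.continuousWithinAt ?_, fun a ha b hb hab => ?_, fun a ha => ?_⟩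
  · rw [mem_Ioi] at ha
    have hcont : ContinuousAt (fun x => ∫ u in (0 : ℝ)..1, (u * √(G x u))⁻¹) a := by
      refine intervalIntegral.continuousAt_of_dominated_interval
        (bound := fun u => (u * √(G (a + 1) u))⁻¹) ?_ ?_ (hint _ (by linarith)) ?_
      · filter_upwards [lt_mem_nhds ha] with x hx
        rw [uIoc_of_le zero_le_one]
        exact (hint x hx).1.aestronglyMeasurable
      · filter_upwards [lt_mem_nhds ha, gt_mem_nhds (lt_add_one a)] with x hx hx'
        refine Eventually.of_forall fun u hu => ?_
        rw [uIoc_of_le zero_le_one] at hu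
        have hu0 := hu.1
        rw [Real.norm_of_nonneg (by positivity)]
        exact hG.inv_mul_sqrt_le hp hx hx' hu
      · refine Eventually.of_forall fun u hu => ?_
        rw [uIoc_of_le zero_le_one] at hu
        exact hG.continuousAt_inv_mul_sqrt hp ha hu
    refine hcont.congr ?_
    filter_upwards [lt_mem_nhds ha] with x hx
    exact (thetaA_eq_intervalIntegral hx).symm
  · rw [mem_Ioi] at ha hb
    rw [thetaA_eq_intervalIntegral ha, thetaA_eq_intervalIntegral hb]
    refine intervalIntegral.integral_lt_integral_of_ae_le_of_measure_setOfPred_lt_ne_zero zero_le_one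
      (hint a ha) (hint b hb) ?_ ?_
    · filter_upwards [ae_restrict_mem measurableSet_Ioc] with u hu
      exact hG.inv_mul_sqrt_le hp ha hab hu
    · have hsub : Ioo (0 : ℝ) 1 ⊆ {u | (u * √(G a u))⁻¹ < (u * √(G b u))⁻¹} :=
        fun u hu => hG.inv_mul_sqrt_lt hp ha hab hu
      refine ((?_ : (0 : ENNReal) < _).trans_le (measure_mono hsub)).ne'
      rw [Measure.restrict_apply measurableSet_Ioo, inter_eq_left.2 Ioo_subset_Ioc_self]
      simp
  · rw [thetaA_eq_intervalIntegral ha, intervalIntegral.integral_of_le zero_le_one,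
      integral_Ioc_eq_integral_Ioo]
end
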